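/- Let B be an instance of (2,2)-E3-SAT, let J be the TAP-SS instance constructed from B as described, and let J′ be the extended TAP-SS instance obtained from J by the gadget construction described. Then in every stable matching M′ of J′, every applicant a of J is assigned in M′ to a school she prefers to g(a), and moreover (a′, g(a)) ∈ M′ for every applicant a of J. -/

import Mathlib

/-- The three subjects. -/
inductive Subj : Type where
  | F | I | M
deriving DecidableEq

/-- An instance of (2,2)-E3-SAT with variables `Fin n` and clauses `Fin m`:
`clause j t` is the literal (variable, polarity) in position `t` of clause `j`;
`occurs v b o` is the (clause, position) of the `o`-th occurrence of the literal
`(v, b)`, and `occInv` is its two-sided inverse, so that each clause has exactly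
3 literals and each literal occurs exactly twice. -/
structure E3SAT (n m : ℕ) where
  clause : Fin m → Fin 3 → Fin n × Bool
  occurs : Fin n → Bool → Fin 2 → Fin m × Fin 3
  occInv : Fin m → Fin 3 → Fin n × Bool × Fin 2
  clause_occurs : ∀ v b o, clause (occurs v b o).1 (occurs v b o).2 = (v, b)
  occurs_occInv : ∀ j t, occurs (occInv j t).1 (occInv j t).2.1 (occInv j t).2.2 = (j, t)
  occInv_occurs : ∀ v b o, occInv (occurs v b o).1 (occurs v b o).2 = (v, b, o)

/-- `f` is a satisfying truth assignment of `B`. -/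
def E3SAT.Satisfies {n m : ℕ} (B : E3SAT n m) (f : Fin n → Bool) : Prop :=
  ∀ j : Fin m, ∃ t : Fin 3, f (B.clause j t).1 = (B.clause j t).2
/-- An instance of TAP-SS: like TAP but each school has a separate preference
list of applicants for each subject. -/
structure TAPSS (A : Type*) (S : Type*) (P : Type*) where
  ptype : A → Finset P
  prefA : A → List S
  cap : S → P → ℕ
  prefSp : S → P → List A

namespace TAPSS

variable {A S P : Type*} [DecidableEq A] [DecidableEq S] [DecidableEq P] (J : TAPSS A S P)

def IsAssignment (M : Finset (A × S)) : Prop :=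
  (∀ x ∈ M, x.2 ∈ J.prefA x.1) ∧
  ∀ a s s', (a, s) ∈ M → (a, s') ∈ M → s = s'

def Mp (M : Finset (A × S)) (s : S) (p : P) : Finset A :=
  (M.filter (fun x => x.2 = s ∧ p ∈ J.ptype x.1)).image Prod.fst

def Mpr (M : Finset (A × S)) (s : S) (p r : P) : Finset A :=
  (M.filter (fun x => x.2 = s ∧ J.ptype x.1 = {p, r})).image Prod.fst

def IsMatching (M : Finset (A × S)) : Prop :=
  J.IsAssignment M ∧ ∀ s p, (J.Mp M s p).card ≤ J.cap s p

def Undersub (M : Finset (A × S)) (s : S) (p : P) : Prop :=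
  (J.Mp M s p).card < J.cap s p

def PrefersA (a : A) (s s' : S) : Prop :=
  s ∈ J.prefA a ∧ s' ∈ J.prefA a ∧ (J.prefA a).idxOf s < (J.prefA a).idxOf s'

/-- School `s` prefers `a` to `a'` in subject `p`. -/
def PrefersS (s : S) (p : P) (a a' : A) : Prop :=
  a ∈ J.prefSp s p ∧ a' ∈ J.prefSp s p ∧
    (J.prefSp s p).idxOf a < (J.prefSp s p).idxOf a'

def Unassigned (M : Finset (A × S)) (a : A) : Prop := ∀ s, (a, s) ∉ M

def Blocks (M : Finset (A × S)) (a : A) (s : S) : Prop :=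
  s ∈ J.prefA a ∧
  (Unassigned M a ∨ ∃ s', (a, s') ∈ M ∧ J.PrefersA a s s') ∧
  ∃ p₁ p₂, p₁ ≠ p₂ ∧ J.ptype a = {p₁, p₂} ∧
    ((J.Undersub M s p₁ ∧ J.Undersub M s p₂) ∨
     (J.Undersub M s p₁ ∧ ∃ b ∈ J.Mp M s p₂, J.PrefersS s p₂ a b) ∨
     (J.Undersub M s p₂ ∧ ∃ b ∈ J.Mp M s p₁, J.PrefersS s p₁ a b) ∨
     (∃ b ∈ J.Mpr M s p₁ p₂, J.PrefersS s p₁ a b ∧ J.PrefersS s p₂ a b) ∨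
     (∃ b₁ ∈ J.Mp M s p₁, ∃ b₂ ∈ J.Mp M s p₂,
        b₁ ≠ b₂ ∧ J.PrefersS s p₁ a b₁ ∧ J.PrefersS s p₂ a b₂))

def Stable (M : Finset (A × S)) : Prop :=
  J.IsMatching M ∧ ∀ a s, ¬ J.Blocks M a s

/-- Every applicant is assigned. -/
def ApplicantComplete (_J : TAPSS A S P) (M : Finset (A × S)) : Prop :=
  ∀ a : A, ∃ s, (a, s) ∈ M

end TAPSS
/-- The applicants of the TAP-SS instance constructed from a (2,2)-E3-SAT instance:
`x i r` is the applicant `x_{4i+r}` of the paper, `q j` is `q_{j+1}` and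
`w j t` is `w_{j+1}^{t+1}`. -/
inductive SApp (n m : ℕ) : Type where
  | x (i : Fin n) (r : Fin 4)
  | q (j : Fin m)
  | w (j : Fin m) (t : Fin 3)
deriving DecidableEq

/-- The schools of the TAP-SS instance constructed from a (2,2)-E3-SAT instance:
`y i r` is the school `y_{4i+r}` of the paper, `s j t` is `s_{j+1}^{t+1}` and
`s4 j` is `s_{j+1}^4`. -/
inductive SSch (n m : ℕ) : Type where
  | y (i : Fin n) (r : Fin 4)
  | s (j : Fin m) (t : Fin 3)
  | s4 (j : Fin m)
deriving DecidableEq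

variable {n m : ℕ}

/-- The school `s(x_{4i+r})` housing the literal occurrence that applicant
`x_{4i+r}` corresponds to. -/
def sx (B : E3SAT n m) (i : Fin n) (r : Fin 4) : SSch n m :=
  if h : r.1 < 2 then
    SSch.s (B.occurs i true ⟨r.1, h⟩).1 (B.occurs i true ⟨r.1, h⟩).2
  else
    SSch.s (B.occurs i false ⟨r.1 - 2, by have := r.2; omega⟩).1
      (B.occurs i false ⟨r.1 - 2, by have := r.2; omega⟩).2

open Subj in
/-- Types of the applicants: all x-applicants are FI, all q- and w-applicants are FM. -/
def ssPtype : SApp n m → Finset Subj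
  | .x _ _ => {F, I}
  | .q _ => {F, M}
  | .w _ _ => {F, M}

/-- Preference lists of the applicants. -/
def ssPrefA (B : E3SAT n m) : SApp n m → List (SSch n m)
  | .x i r =>
      if r = 0 then [.y i 0, sx B i r, .y i 1]
      else if r = 1 then [.y i 1, sx B i r, .y i 2]
      else if r = 2 then [.y i 3, sx B i r, .y i 2]
      else [.y i 0, sx B i r, .y i 3]
  | .q j => [.s j 0, .s j 1, .s j 2]
  | .w j t => [.s j t, .s4 j]

open Subj in
/-- Capacities of the schools. -/
def ssCap : SSch n m → Subj → ℕ
  | .y _ _, p => if p = M then 0 else 1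
  | .s _ _, _ => 1
  | .s4 _, p => if p = I then 0 else 1

/-- `⟨X⟩`: the x-applicants in increasing subscript order. -/
def Xlist (n m : ℕ) : List (SApp n m) :=
  (List.finRange n).flatMap fun i => (List.finRange 4).map fun r => SApp.x i r

/-- `⟨Q⟩`: the q-applicants in increasing subscript order. -/
def Qlist (n m : ℕ) : List (SApp n m) := (List.finRange m).map SApp.q

/-- `⟨W⟩`: the w-applicants ordered by increasing subscript and, within equal
subscript, increasing superscript. -/
def Wlist (n m : ℕ) : List (SApp n m) :=
  (List.finRange m).flatMap fun j => (List.finRange 3).map fun t => SApp.w j t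

open Subj in
/-- The subject-specific master lists of applicants:
F: ⟨W⟩ ⟨X⟩ ⟨Q⟩; I: ⟨X̄⟩; M: ⟨Q⟩ ⟨W̄⟩. -/
def ssMaster (n m : ℕ) : Subj → List (SApp n m)
  | F => Wlist n m ++ Xlist n m ++ Qlist n m
  | I => (Xlist n m).reverse
  | M => Qlist n m ++ (Wlist n m).reverse

/-- The TAP-SS instance `J` constructed from the (2,2)-E3-SAT instance `B`;
each school's preference list for subject `p` is the restriction of the master
list for `p` to the applicants whose type includes `p` and who find the school
acceptable. -/
def ssOf (B : E3SAT n m) : TAPSS (SApp n m) (SSch n m) Subj where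
  ptype := ssPtype
  prefA := ssPrefA B
  cap s p := ssCap s p
  prefSp s p := (ssMaster n m p).filter
    (fun a => decide (s ∈ ssPrefA B a) && decide (p ∈ ssPtype a))

/-- The set of pairs `T_i = {(x_{4i+r}, y_{4i+r}) : 0 ≤ r ≤ 3}`. -/
def ssT (i : Fin n) : Finset (SApp n m × SSch n m) :=
  {(.x i 0, .y i 0), (.x i 1, .y i 1), (.x i 2, .y i 2), (.x i 3, .y i 3)}

/-- The set of pairs `F_i = {(x_{4i+r}, y_{4i+r+1}) : 0 ≤ r ≤ 2} ∪ {(x_{4i+3}, y_{4i})}`. -/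
def ssF (i : Fin n) : Finset (SApp n m × SSch n m) :=
  {(.x i 0, .y i 1), (.x i 1, .y i 2), (.x i 2, .y i 3), (.x i 3, .y i 0)}
/-- The applicants of the extended instance `J′`: `base a` is an original applicant
`a` of `J`, and `p1 a`, `p2 a` are the new applicants `a′` and `a″`. -/
inductive SApp' (n m : ℕ) : Type where
  | base (a : SApp n m)
  | p1 (a : SApp n m)
  | p2 (a : SApp n m)
deriving DecidableEq

/-- The schools of the extended instance `J′`: `base s` is an original school of
`J`, and `g a` is the new school `g(a)` for each original applicant `a`. -/
inductive SSch' (n m : ℕ) : Type where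
  | base (s : SSch n m)
  | g (a : SApp n m)
deriving DecidableEq

open Subj in
/-- Types in `J′`: original applicants keep their types; if `a` has type FI then
`a′` has type FM, and if `a` has type FM then `a′` has type FI; `a″` always has
type IM. -/
def ssPtype' : SApp' n m → Finset Subj
  | .base a => ssPtype a
  | .p1 a => match a with
      | .x _ _ => {F, M}
      | _ => {F, I}
  | .p2 _ => {I, M}

/-- Preference lists in `J′`: `g a` is appended to `a`'s preference list, and the
new applicants `a′`, `a″` find only `g a` acceptable. -/
def ssPrefA' (B : E3SAT n m) : SApp' n m → List (SSch' n m)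
  | .base a => (ssPrefA B a).map SSch'.base ++ [.g a]
  | .p1 a => [.g a]
  | .p2 a => [.g a]

/-- Capacities in `J′`: original schools keep their capacities and each new school
`g a` has capacity 1 in every subject. -/
def ssCap' : SSch' n m → Subj → ℕ
  | .base s, p => ssCap s p
  | .g _, _ => 1

open Subj in
/-- The subject-specific master lists of `J′`:
F: ⟨W⟩ ⟨X⟩ ⟨Q⟩ ⟨X′⟩ ⟨R′⟩; I: ⟨X″⟩ ⟨R′⟩ ⟨R″⟩ ⟨X̄⟩; M: ⟨R″⟩ ⟨Q⟩ ⟨W̄⟩ ⟨X′⟩ ⟨X″⟩,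
where `LX1 = ⟨X′⟩`, `LX2 = ⟨X″⟩`, `LR1 = ⟨R′⟩`, `LR2 = ⟨R″⟩` are the chosen fixed
orderings of the sets of new applicants. -/
def ssMaster' (n m : ℕ) (LX1 LX2 LR1 LR2 : List (SApp' n m)) : Subj → List (SApp' n m)
  | F => (Wlist n m ++ Xlist n m ++ Qlist n m).map SApp'.base ++ LX1 ++ LR1
  | I => LX2 ++ LR1 ++ LR2 ++ ((Xlist n m).reverse).map SApp'.base
  | M => LR2 ++ (Qlist n m ++ (Wlist n m).reverse).map SApp'.base ++ LX1 ++ LX2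

/-- The extended TAP-SS instance `J′` constructed from `B` (with chosen orderings
of the new applicants); each school's preference list for subject `p` is the
restriction of the master list for `p` to the applicants whose type includes `p`
and who find the school acceptable. -/
def ssOf' (B : E3SAT n m) (LX1 LX2 LR1 LR2 : List (SApp' n m)) :
    TAPSS (SApp' n m) (SSch' n m) Subj where
  ptype := ssPtype'
  prefA := ssPrefA' B
  cap s p := ssCap' s p
  prefSp s p := (ssMaster' n m LX1 LX2 LR1 LR2 p).filter
    (fun a => decide (s ∈ ssPrefA' B a) && decide (p ∈ ssPtype' a))

/-- The hypothesis that `LX1, LX2, LR1, LR2` are indeed orderings of the sets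
`X′`, `X″`, `R′` and `R″` respectively. -/
def ssOrderings (n m : ℕ) (LX1 LX2 LR1 LR2 : List (SApp' n m)) : Prop :=
  LX1.Perm ((Xlist n m).map SApp'.p1) ∧ LX2.Perm ((Xlist n m).map SApp'.p2) ∧
  LR1.Perm ((Qlist n m ++ Wlist n m).map SApp'.p1) ∧
  LR2.Perm ((Qlist n m ++ Wlist n m).map SApp'.p2)

namespace TAPSS

variable {A S P : Type*} [DecidableEq A] [DecidableEq S] [DecidableEq P] {J : TAPSS A S P}

theorem mem_Mp {M : Finset (A × S)} {s : S} {p : P} {a : A} :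
    a ∈ J.Mp M s p ↔ (a, s) ∈ M ∧ p ∈ J.ptype a := by
  simp [Mp]

theorem undersub_of_forall_notMem {M : Finset (A × S)} {s : S} {p : P}
    (hcap : 0 < J.cap s p) (h : ∀ a, (a, s) ∈ M → p ∉ J.ptype a) : J.Undersub M s p := by
  have hempty : J.Mp M s p = ∅ :=
    Finset.eq_empty_of_forall_notMem fun a ha => h a (mem_Mp.1 ha).1 (mem_Mp.1 ha).2
  simpa [Undersub, hempty] using hcap

/-- In a matching, two applicants sharing a subject in which a school has capacity one
cannot both be assigned to that school. -/
theorem IsMatching.eq_of_mem {M : Finset (A × S)} (hM : J.IsMatching M) {s : S} {p : P}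
    (hcap : J.cap s p = 1) {a b : A} (ha : (a, s) ∈ M) (hb : (b, s) ∈ M)
    (hpa : p ∈ J.ptype a) (hpb : p ∈ J.ptype b) : a = b :=
  Finset.card_le_one.1 (hcap ▸ hM.2 s p) a (mem_Mp.2 ⟨ha, hpa⟩) b (mem_Mp.2 ⟨hb, hpb⟩)

/-- An unassigned applicant of type `{p, r}` blocks with a school occupied only by an applicant
without subject `p` to whom the school prefers her in subject `r`. -/
theorem Stable.false_of_sole_occupant {M : Finset (A × S)} (hM : J.Stable M) {s : S} {p r : P}
    {a b : A} (hcap : J.cap s p = 1) (hs : s ∈ J.prefA a) (hpr : p ≠ r)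
    (htype : J.ptype a = {p, r}) (ha : Unassigned M a) (hb : (b, s) ∈ M)
    (hsole : ∀ d, (d, s) ∈ M → d = b) (hpb : p ∉ J.ptype b) (hrb : r ∈ J.ptype b)
    (hpref : J.PrefersS s r a b) : False := by
  refine hM.2 a s ⟨hs, Or.inl ha, p, r, hpr, htype, Or.inr (Or.inl ⟨?_, b, ?_, hpref⟩)⟩
  · exact undersub_of_forall_notMem (by omega) fun d hd => hsole d hd ▸ hpb
  · exact mem_Mp.2 ⟨hb, hrb⟩

/-- A school `g` of unit capacities accepting just three applicants with cyclic preferences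
forces `a`, for whom `g` is the last choice, to be assigned elsewhere and `b` to `g`. -/
theorem Stable.cyclic_gadget {M : Finset (A × S)} (hM : J.Stable M) {g : S} {u v w : P}
    {a b c : A} (huv : u ≠ v) (huw : u ≠ w) (hvw : v ≠ w)
    (hu : J.cap g u = 1) (hv : J.cap g v = 1) (hw : J.cap g w = 1)
    (ta : J.ptype a = {u, v}) (tb : J.ptype b = {u, w}) (tc : J.ptype c = {v, w})
    {l : List S} (hga : g ∉ l) (pa : J.prefA a = l ++ [g])
    (pb : J.prefA b = [g]) (pc : J.prefA c = [g])
    (hacc : ∀ d, g ∈ J.prefA d → d = a ∨ d = b ∨ d = c)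
    (hab : J.PrefersS g u a b) (hbc : J.PrefersS g w b c) (hca : J.PrefersS g v c a) :
    (∃ s, (a, s) ∈ M ∧ J.PrefersA a s g) ∧ (b, g) ∈ M := by
  have occ : ∀ d, (d, g) ∈ M → d = a ∨ d = b ∨ d = c := fun d hd => hacc d (hM.1.1.1 _ hd)
  have sole : ∀ d e, (d, g) ∈ M → (e, g) ∈ M → d = e := by
    intro d e hd he
    have hshare : ∃ p, J.cap g p = 1 ∧ p ∈ J.ptype d ∧ p ∈ J.ptype e := by
      rcases occ d hd with rfl | rfl | rfl <;> rcases occ e he with rfl | rfl | rfl <;>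
        first
          | refine ⟨u, hu, ?_, ?_⟩ <;> simp [ta, tb, tc] <;> done
          | refine ⟨v, hv, ?_, ?_⟩ <;> simp [ta, tb, tc] <;> done
          | refine ⟨w, hw, ?_, ?_⟩ <;> simp [tb, tc]
    obtain ⟨p, hp, hpd, hpe⟩ := hshare
    exact hM.1.eq_of_mem hp hd he hpd hpe
  have ub : (b, g) ∉ M → Unassigned M b := fun h s hs => by
    have := hM.1.1.1 _ hs
    simp only [pb, List.mem_singleton] at this
    exact h (this ▸ hs)
  have uc : (c, g) ∉ M → Unassigned M c := fun h s hs => by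
    have := hM.1.1.1 _ hs
    simp only [pc, List.mem_singleton] at this
    exact h (this ▸ hs)
  have hac : a ≠ c := by
    rintro rfl
    exact absurd hca.2.2 (lt_irrefl _)
  have hbc' : b ≠ c := by
    rintro rfl
    exact absurd hbc.2.2 (lt_irrefl _)
  have na : (a, g) ∉ M := fun h =>
    hM.false_of_sole_occupant hw (by simp [pc]) hvw.symm (by rw [tc, Finset.pair_comm])
      (uc fun hc => hac (sole _ _ h hc)) h (fun d hd => sole _ _ hd h)
      (by simp [ta, huw.symm, hvw.symm]) (by simp [ta]) hca
  have nc : (c, g) ∉ M := fun h =>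
    hM.false_of_sole_occupant hu (by simp [pb]) huw tb
      (ub fun hb => hbc' (sole _ _ hb h)) h (fun d hd => sole _ _ hd h)
      (by simp [tc, huv, huw]) (by simp [tc]) hbc
  have mb : (b, g) ∈ M := by
    by_contra nb
    have hempty : ∀ d, (d, g) ∉ M := fun d hd => by
      rcases occ d hd with rfl | rfl | rfl <;> contradiction
    exact hM.2 b g ⟨by simp [pb], Or.inl (ub nb), u, w, huw, tb, Or.inl
      ⟨undersub_of_forall_notMem (by omega) fun d hd => absurd hd (hempty d),
        undersub_of_forall_notMem (by omega) fun d hd => absurd hd (hempty d)⟩⟩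
  refine ⟨?_, mb⟩
  by_cases ha : Unassigned M a
  · exact (hM.false_of_sole_occupant hv (by simp [pa]) huv.symm (by rw [ta, Finset.pair_comm])
      ha mb (fun d hd => sole _ _ hd mb) (by simp [tb, huv.symm, hvw]) (by simp [tb]) hab).elim
  · simp only [Unassigned, not_forall, not_not] at ha
    obtain ⟨s, hs⟩ := ha
    have hsl : s ∈ l := by
      have hmem := hM.1.1.1 _ hs
      simp only [pa, List.mem_append, List.mem_singleton] at hmem
      rcases hmem with h | rfl
      · exact h
      · exact absurd hs na
    refine ⟨s, hs, by simp [pa, hsl], by simp [pa], ?_⟩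
    rw [pa, List.idxOf_append_of_mem hsl, List.idxOf_append_of_notMem hga]
    exact Nat.lt_add_right _ (List.idxOf_lt_length_of_mem hsl)

end TAPSS

theorem List.idxOf_filter_append_lt {α : Type*} [DecidableEq α] {L₁ L₂ : List α} {f : α → Bool}
    {a b : α} (ha : a ∈ L₁) (hb : b ∉ L₁) (hfa : f a) :
    ((L₁ ++ L₂).filter f).idxOf a < ((L₁ ++ L₂).filter f).idxOf b := by
  have ha' : a ∈ L₁.filter f := List.mem_filter.2 ⟨ha, hfa⟩
  have hb' : b ∉ L₁.filter f := fun h => hb (List.mem_filter.1 h).1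
  rw [List.filter_append, List.idxOf_append_of_mem ha', List.idxOf_append_of_notMem hb']
  exact Nat.lt_add_right _ (List.idxOf_lt_length_of_mem ha')

/-- A school of `J′` prefers an applicant in an initial segment of the master list to a later
one, provided both have the subject and find the school acceptable. -/
theorem prefersS_ssOf' {B : E3SAT n m} {LX1 LX2 LR1 LR2 L₁ L₂ : List (SApp' n m)} {p : Subj}
    (hL : ssMaster' n m LX1 LX2 LR1 LR2 p = L₁ ++ L₂) {s : SSch' n m} {a b : SApp' n m}
    (ha : a ∈ L₁) (hb : b ∈ L₂) (hb' : b ∉ L₁) (hsa : s ∈ ssPrefA' B a) (hsb : s ∈ ssPrefA' B b)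
    (hpa : p ∈ ssPtype' a) (hpb : p ∈ ssPtype' b) :
    (ssOf' B LX1 LX2 LR1 LR2).PrefersS s p a b := by
  simp only [TAPSS.PrefersS, ssOf', hL]
  exact ⟨by simp [ha, hsa, hpa], by simp [hb, hsb, hpb],
    List.idxOf_filter_append_lt ha hb' (by simp [hsa, hpa])⟩

theorem x_mem_Xlist (i : Fin n) (r : Fin 4) : (SApp.x i r : SApp n m) ∈ Xlist n m := by
  simp only [Xlist, List.mem_flatMap, List.mem_map]
  exact ⟨i, List.mem_finRange i, r, List.mem_finRange r, rfl⟩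

theorem q_mem_Qlist (j : Fin m) : (SApp.q j : SApp n m) ∈ Qlist n m :=
  List.mem_map.2 ⟨j, List.mem_finRange j, rfl⟩

theorem w_mem_Wlist (j : Fin m) (t : Fin 3) : (SApp.w j t : SApp n m) ∈ Wlist n m := by
  simp only [Wlist, List.mem_flatMap, List.mem_map]
  exact ⟨j, List.mem_finRange j, t, List.mem_finRange t, rfl⟩

theorem eq_of_g_mem_ssPrefA' {B : E3SAT n m} {a : SApp n m} {d : SApp' n m}
    (h : SSch'.g a ∈ ssPrefA' B d) : d = .base a ∨ d = .p1 a ∨ d = .p2 a := by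
  cases d <;> simp [ssPrefA'] at h <;> simp [h]

/-- The gadget at `g a`, for `a` of type `{F, v}` with `w` the third subject. -/
theorem ssOf'_gadget (B : E3SAT n m) (LX1 LX2 LR1 LR2 : List (SApp' n m))
    {M' : Finset (SApp' n m × SSch' n m)} (hst : (ssOf' B LX1 LX2 LR1 LR2).Stable M')
    {a : SApp n m} {v w : Subj} (hv : Subj.F ≠ v) (hw : Subj.F ≠ w) (hvw : v ≠ w)
    (ta : ssPtype a = {.F, v}) (tb : ssPtype' (.p1 a) = {.F, w})
    (tc : ssPtype' (.p2 a) = {v, w})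
    (hab : (ssOf' B LX1 LX2 LR1 LR2).PrefersS (.g a) .F (.base a) (.p1 a))
    (hbc : (ssOf' B LX1 LX2 LR1 LR2).PrefersS (.g a) w (.p1 a) (.p2 a))
    (hca : (ssOf' B LX1 LX2 LR1 LR2).PrefersS (.g a) v (.p2 a) (.base a)) :
    (∃ s, (SApp'.base a, s) ∈ M' ∧
      (ssOf' B LX1 LX2 LR1 LR2).PrefersA (SApp'.base a) s (SSch'.g a)) ∧
    (SApp'.p1 a, SSch'.g a) ∈ M' :=
  hst.cyclic_gadget (c := .p2 a) hv hw hvw rfl rfl rfl ta tb tc (by simp) rfl rfl rfl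
    (fun _ => eq_of_g_mem_ssPrefA') hab hbc hca

theorem stmt12 {n m : ℕ} (B : E3SAT n m) (LX1 LX2 LR1 LR2 : List (SApp' n m))
    (hord : ssOrderings n m LX1 LX2 LR1 LR2)
    (M' : Finset (SApp' n m × SSch' n m))
    (hst : (ssOf' B LX1 LX2 LR1 LR2).Stable M') (a : SApp n m) :
    (∃ s, (SApp'.base a, s) ∈ M' ∧
      (ssOf' B LX1 LX2 LR1 LR2).PrefersA (SApp'.base a) s (SSch'.g a)) ∧
    (SApp'.p1 a, SSch'.g a) ∈ M' := by
  obtain ⟨hX1, hX2, hR1, hR2⟩ := hord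
  have fm : ∀ a : SApp n m, ssPtype a = {.F, .M} → ssPtype' (.p1 a) = {.F, .I} →
      a ∈ Qlist n m ++ Wlist n m → (∃ s, (SApp'.base a, s) ∈ M' ∧
        (ssOf' B LX1 LX2 LR1 LR2).PrefersA (SApp'.base a) s (SSch'.g a)) ∧
      (SApp'.p1 a, SSch'.g a) ∈ M' := by
    intro a ta tb ha
    have tbase : ssPtype' (.base a) = {.F, .M} := ta
    have tc : ssPtype' (.p2 a) = {.M, .I} := by simp only [ssPtype']; decide
    have ha' := List.mem_append.1 ha
    have hX : a ∉ Xlist n m := by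
      intro h
      simp only [Xlist, List.mem_flatMap, List.mem_map] at h
      obtain ⟨i, -, r, -, rfl⟩ := h
      exact absurd ta (by simp only [ssPtype]; decide)
    refine ssOf'_gadget B LX1 LX2 LR1 LR2 hst (v := .M) (w := .I) (by decide) (by decide)
      (by decide) ta tb tc ?_ ?_ ?_
    · refine prefersS_ssOf' (L₁ := (Wlist n m ++ Xlist n m ++ Qlist n m).map SApp'.base)
        (L₂ := LX1 ++ LR1) (by simp [ssMaster']) ?_ ?_ ?_ ?_ ?_ ?_ ?_
      · simp only [List.mem_map, List.mem_append]
        exact ⟨a, by tauto, rfl⟩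
      all_goals simp [hR1.mem_iff, ha', hX1.mem_iff, ssPrefA', tb, tbase]
    · refine prefersS_ssOf' (L₁ := LX2 ++ LR1)
        (L₂ := LR2 ++ (Xlist n m).reverse.map SApp'.base) (by simp [ssMaster'])
        ?_ ?_ ?_ ?_ ?_ ?_ ?_ <;>
        simp [hX2.mem_iff, hR1.mem_iff, hR2.mem_iff, ha', hX, ssPrefA', tb, tc]
    · refine prefersS_ssOf' (L₁ := LR2)
        (L₂ := (Qlist n m ++ (Wlist n m).reverse).map SApp'.base ++ LX1 ++ LX2)
        (by simp [ssMaster']) ?_ ?_ ?_ ?_ ?_ ?_ ?_ <;>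
        simp [hR2.mem_iff, ha', ssPrefA', tc, tbase, ← or_assoc]
  cases a with
  | x i r =>
    have hx := x_mem_Xlist (m := m) i r
    refine ssOf'_gadget B LX1 LX2 LR1 LR2 hst (v := .I) (w := .M) (by decide) (by decide)
      (by decide) rfl rfl rfl ?_ ?_ ?_
    · refine prefersS_ssOf' (L₁ := (Wlist n m ++ Xlist n m ++ Qlist n m).map SApp'.base)
        (L₂ := LX1 ++ LR1) (by simp [ssMaster']) ?_ ?_ ?_ ?_ ?_ ?_ ?_ <;>
        simp [hX1.mem_iff, hx, ssPrefA', ssPtype', ssPtype]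
    · refine prefersS_ssOf'
        (L₁ := LR2 ++ (Qlist n m ++ (Wlist n m).reverse).map SApp'.base ++ LX1) (L₂ := LX2)
        (by simp [ssMaster']) ?_ ?_ ?_ ?_ ?_ ?_ ?_ <;>
        simp [hX1.mem_iff, hX2.mem_iff, hR2.mem_iff, hx, ssPrefA', ssPtype', Qlist, Wlist]
    · refine prefersS_ssOf' (L₁ := LX2 ++ LR1 ++ LR2)
        (L₂ := (Xlist n m).reverse.map SApp'.base) (by simp [ssMaster'])
        ?_ ?_ ?_ ?_ ?_ ?_ ?_ <;>
        simp [hX2.mem_iff, hR1.mem_iff, hR2.mem_iff, hx, ssPrefA', ssPtype', ssPtype]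
  | q j => exact fm _ rfl rfl (by simp [q_mem_Qlist])
  | w j t => exact fm _ rfl rfl (by simp [w_mem_Wlist])
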